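/- Let N₁, N₂, N₃, R be positive integers, let X ∈ ℝ^{N₁×N₂×N₃} be a tensor such that U_R(X) is nonempty, and let η ≥ 0. Then the infimum over u ∈ U_R(X) of Ω₂²(u) = (1/3)·Σ_{r=1}^R Σ_{d=1}^3 ‖u_r^{(d)}‖₂² is at most η if and only if the infimum over u ∈ U_R(X) of ‖σ(u)‖_{2/3} := (Σ_{r=1}^R (‖u_r^{(1)}‖₂ · ‖u_r^{(2)}‖₂ · ‖u_r^{(3)}‖₂)^{2/3})^{3/2} is at most η^{3/2}. -/

import Mathlib

open Finset

/-- The vector ℓ_p norm on `ℝ^n`. -/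
noncomputable def vecLpNorm (p : ℝ) {n : ℕ} (v : Fin n → ℝ) : ℝ :=
  (∑ i, |v i| ^ p) ^ (1 / p)

/-- `u = (u1, u2, u3)` is a rank-`R` CP decomposition of the tensor `X`. -/
def IsCPDecomp {N₁ N₂ N₃ R : ℕ} (X : Fin N₁ × Fin N₂ × Fin N₃ → ℝ)
    (u1 : Fin R → Fin N₁ → ℝ) (u2 : Fin R → Fin N₂ → ℝ)
    (u3 : Fin R → Fin N₃ → ℝ) : Prop :=
  ∀ i j k, X (i, j, k) = ∑ r, u1 r i * u2 r j * u3 r k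

theorem vecLpNorm_nonneg (p : ℝ) {n : ℕ} (v : Fin n → ℝ) : 0 ≤ vecLpNorm p v :=
  Real.rpow_nonneg (sum_nonneg fun _ _ => Real.rpow_nonneg (abs_nonneg _) _) _

theorem vecLpNorm_smul {p : ℝ} (hp : 0 < p) {n : ℕ} {c : ℝ} (hc : 0 ≤ c) (v : Fin n → ℝ) :
    vecLpNorm p (c • v) = c * vecLpNorm p v := by
  have hs : 0 ≤ ∑ i, |v i| ^ p := sum_nonneg fun _ _ => Real.rpow_nonneg (abs_nonneg _) _
  have h : ∑ i, |(c • v) i| ^ p = c ^ p * ∑ i, |v i| ^ p := by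
    rw [mul_sum]
    refine sum_congr rfl fun i _ => ?_
    rw [Pi.smul_apply, smul_eq_mul, abs_mul, abs_of_nonneg hc,
      Real.mul_rpow hc (abs_nonneg _)]
  rw [vecLpNorm, vecLpNorm, h, Real.mul_rpow (Real.rpow_nonneg hc _) hs, one_div,
    Real.rpow_rpow_inv hc hp.ne']

theorem eq_zero_of_vecLpNorm_eq_zero {p : ℝ} (hp : 0 < p) {n : ℕ} {v : Fin n → ℝ}
    (h : vecLpNorm p v = 0) : v = 0 := by
  have hnn : ∀ i ∈ univ, 0 ≤ |v i| ^ p := fun _ _ => Real.rpow_nonneg (abs_nonneg _) _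
  rw [vecLpNorm, Real.rpow_eq_zero (sum_nonneg hnn) (one_div_pos.2 hp).ne',
    sum_eq_zero_iff_of_nonneg hnn] at h
  funext i
  simpa using (Real.rpow_eq_zero (abs_nonneg _) hp.ne').1 (h i (mem_univ i))

/-- The inequality of arithmetic and geometric means for `a ^ 2`, `b ^ 2`, `c ^ 2`. -/
theorem mul_rpow_two_thirds_le {a b c : ℝ} (ha : 0 ≤ a) (hb : 0 ≤ b) (hc : 0 ≤ c) :
    (a * b * c) ^ ((2 : ℝ) / 3) ≤ 1 / 3 * (a ^ (2 : ℝ) + b ^ (2 : ℝ) + c ^ (2 : ℝ)) := by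
  have h := Real.geom_mean_le_arith_mean3_weighted (w₁ := 1 / 3) (w₂ := 1 / 3) (w₃ := 1 / 3)
    (by norm_num) (by norm_num) (by norm_num) (Real.rpow_nonneg ha 2) (Real.rpow_nonneg hb 2)
    (Real.rpow_nonneg hc 2) (by norm_num)
  rw [← Real.rpow_mul ha, ← Real.rpow_mul hb, ← Real.rpow_mul hc, mul_one_div] at h
  rw [Real.mul_rpow (mul_nonneg ha hb) hc, Real.mul_rpow ha hb]
  linarith

/-- A rank-one term can be rescaled so that its three factors have equal norm. -/
theorem exists_balanced_factors {N₁ N₂ N₃ : ℕ} (x : Fin N₁ → ℝ) (y : Fin N₂ → ℝ)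
    (z : Fin N₃ → ℝ) :
    ∃ (x' : Fin N₁ → ℝ) (y' : Fin N₂ → ℝ) (z' : Fin N₃ → ℝ),
      (∀ i j k, x' i * y' j * z' k = x i * y j * z k) ∧
      1 / 3 * (vecLpNorm 2 x' ^ (2 : ℝ) + vecLpNorm 2 y' ^ (2 : ℝ) + vecLpNorm 2 z' ^ (2 : ℝ)) =
        (vecLpNorm 2 x * vecLpNorm 2 y * vecLpNorm 2 z) ^ ((2 : ℝ) / 3) := by
  have hx := vecLpNorm_nonneg 2 x
  have hy := vecLpNorm_nonneg 2 y
  have hz := vecLpNorm_nonneg 2 z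
  set a := vecLpNorm 2 x with ha
  set b := vecLpNorm 2 y with hb
  set c := vecLpNorm 2 z with hc
  have hσ : 0 ≤ a * b * c := by positivity
  by_cases h0 : a * b * c = 0
  · refine ⟨0, 0, 0, fun i j k => ?_, ?_⟩
    · rcases mul_eq_zero.1 h0 with h | h
      · rcases mul_eq_zero.1 h with h | h
        · simp [eq_zero_of_vecLpNorm_eq_zero two_pos (ha.symm.trans h)]
        · simp [eq_zero_of_vecLpNorm_eq_zero two_pos (hb.symm.trans h)]
      · simp [eq_zero_of_vecLpNorm_eq_zero two_pos (hc.symm.trans h)]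
    · have hz0 : ∀ n : ℕ, vecLpNorm 2 (0 : Fin n → ℝ) = 0 := fun n => by
        simpa using vecLpNorm_smul two_pos le_rfl (0 : Fin n → ℝ)
      rw [h0, hz0, hz0, hz0, Real.zero_rpow two_ne_zero, Real.zero_rpow (by norm_num)]
      norm_num
  · have ha0 : a ≠ 0 := fun h => h0 (by simp [h])
    have hb0 : b ≠ 0 := fun h => h0 (by simp [h])
    have hc0 : c ≠ 0 := fun h => h0 (by simp [h])
    set t := (a * b * c) ^ ((1 : ℝ) / 3) with ht
    have ht0 : 0 ≤ t := Real.rpow_nonneg hσ _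
    have ht3 : t ^ 3 = a * b * c := by
      rw [ht, ← Real.rpow_natCast, ← Real.rpow_mul hσ]
      norm_num
    have ht2 : t ^ (2 : ℝ) = (a * b * c) ^ ((2 : ℝ) / 3) := by
      rw [ht, ← Real.rpow_mul hσ]
      norm_num
    refine ⟨(t / a) • x, (t / b) • y, (t / c) • z, fun i j k => ?_, ?_⟩
    · simp only [Pi.smul_apply, smul_eq_mul]
      have h1 : t / a * (t / b) * (t / c) = 1 := by
        field_simp
        linarith
      linear_combination (x i * y j * z k) * h1
    · rw [vecLpNorm_smul two_pos (by positivity), vecLpNorm_smul two_pos (by positivity),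
        vecLpNorm_smul two_pos (by positivity), ← ha, ← hb, ← hc, div_mul_cancel₀ t ha0,
        div_mul_cancel₀ t hb0, div_mul_cancel₀ t hc0, ← ht2]
      ring

/-- If every `p`-th power of an element of `A` dominates an element of `B`, and every `p`-th root of
an element of `B` lies in `A`, then `sInf A ≤ η` and `sInf B ≤ η ^ p` are equivalent. -/
theorem sInf_le_iff_sInf_le_rpow {A B : Set ℝ} {p η : ℝ} (hp : 0 < p) (hη : 0 ≤ η)
    (hA : ∀ y ∈ A, 0 ≤ y) (hB : ∀ y ∈ B, 0 ≤ y) (hne : A.Nonempty)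
    (hAB : ∀ y ∈ A, ∃ z ∈ B, z ≤ y ^ p) (hBA : ∀ z ∈ B, z ^ p⁻¹ ∈ A) :
    sInf A ≤ η ↔ sInf B ≤ η ^ p := by
  have hA0 : 0 ≤ sInf A := Real.sInf_nonneg hA
  have hB0 : 0 ≤ sInf B := Real.sInf_nonneg hB
  have hneB : B.Nonempty := by
    obtain ⟨y, hy⟩ := hne
    obtain ⟨z, hz, -⟩ := hAB y hy
    exact ⟨z, hz⟩
  have heq : sInf B = sInf A ^ p := by
    apply le_antisymm
    · rw [← Real.rpow_inv_le_iff_of_pos hB0 hA0 hp]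
      refine le_csInf hne fun y hy => ?_
      obtain ⟨z, hz, hzy⟩ := hAB y hy
      rw [Real.rpow_inv_le_iff_of_pos hB0 (hA y hy) hp]
      exact (csInf_le ⟨0, hB⟩ hz).trans hzy
    · refine le_csInf hneB fun z hz => ?_
      rw [← Real.le_rpow_inv_iff_of_pos hA0 (hB z hz) hp]
      exact csInf_le ⟨0, hA⟩ (hBA z hz)
  rw [heq, Real.rpow_le_rpow_iff hA0 hη hp]

theorem stmt_4 {N₁ N₂ N₃ R : ℕ} (hN₁ : 0 < N₁) (hN₂ : 0 < N₂) (hN₃ : 0 < N₃)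
    (hR : 0 < R) (X : Fin N₁ × Fin N₂ × Fin N₃ → ℝ) (η : ℝ) (hη : 0 ≤ η)
    (hne : ∃ (u1 : Fin R → Fin N₁ → ℝ) (u2 : Fin R → Fin N₂ → ℝ)
      (u3 : Fin R → Fin N₃ → ℝ), IsCPDecomp X u1 u2 u3) :
    sInf {y : ℝ | ∃ (u1 : Fin R → Fin N₁ → ℝ) (u2 : Fin R → Fin N₂ → ℝ)
        (u3 : Fin R → Fin N₃ → ℝ), IsCPDecomp X u1 u2 u3 ∧
        y = (1 / 3) * ∑ r, (vecLpNorm 2 (u1 r) ^ (2 : ℝ) + vecLpNorm 2 (u2 r) ^ (2 : ℝ)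
          + vecLpNorm 2 (u3 r) ^ (2 : ℝ))} ≤ η ↔
    sInf {y : ℝ | ∃ (u1 : Fin R → Fin N₁ → ℝ) (u2 : Fin R → Fin N₂ → ℝ)
        (u3 : Fin R → Fin N₃ → ℝ), IsCPDecomp X u1 u2 u3 ∧
        y = (∑ r, (vecLpNorm 2 (u1 r) * vecLpNorm 2 (u2 r) * vecLpNorm 2 (u3 r))
          ^ ((2 : ℝ) / 3)) ^ ((3 : ℝ) / 2)} ≤ η ^ ((3 : ℝ) / 2) := by
  have hn : ∀ {n : ℕ} (v : Fin n → ℝ), 0 ≤ vecLpNorm 2 v := fun v => vecLpNorm_nonneg 2 v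
  have hS : ∀ (u1 : Fin R → Fin N₁ → ℝ) (u2 : Fin R → Fin N₂ → ℝ) (u3 : Fin R → Fin N₃ → ℝ),
      0 ≤ ∑ r, (vecLpNorm 2 (u1 r) * vecLpNorm 2 (u2 r) * vecLpNorm 2 (u3 r)) ^ ((2 : ℝ) / 3) :=
    fun u1 u2 u3 => sum_nonneg fun r _ =>
      Real.rpow_nonneg (mul_nonneg (mul_nonneg (hn _) (hn _)) (hn _)) _
  apply sInf_le_iff_sInf_le_rpow (by norm_num) hη
  · rintro y ⟨u1, u2, u3, -, rfl⟩
    exact mul_nonneg (by norm_num) (sum_nonneg fun r _ => add_nonneg (add_nonneg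
      (Real.rpow_nonneg (hn _) _) (Real.rpow_nonneg (hn _) _)) (Real.rpow_nonneg (hn _) _))
  · rintro y ⟨u1, u2, u3, -, rfl⟩
    exact Real.rpow_nonneg (hS u1 u2 u3) _
  · obtain ⟨u1, u2, u3, hu⟩ := hne
    exact ⟨_, u1, u2, u3, hu, rfl⟩
  · rintro y ⟨u1, u2, u3, hu, rfl⟩
    refine ⟨_, ⟨u1, u2, u3, hu, rfl⟩, Real.rpow_le_rpow (hS u1 u2 u3) ?_ (by norm_num)⟩
    rw [mul_sum]
    exact sum_le_sum fun r _ => mul_rpow_two_thirds_le (hn _) (hn _) (hn _)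
  · rintro z ⟨u1, u2, u3, hu, rfl⟩
    choose v1 v2 v3 hv hnorm using fun r => exists_balanced_factors (u1 r) (u2 r) (u3 r)
    refine ⟨v1, v2, v3, fun i j k => ?_, ?_⟩
    · rw [hu i j k]
      exact sum_congr rfl fun r _ => (hv r i j k).symm
    · rw [Real.rpow_rpow_inv (hS u1 u2 u3) (by norm_num), mul_sum]
      exact sum_congr rfl fun r _ => (hnorm r).symm
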